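/- Let d be a real number with 0 < d < 1/2 and, for a positive integer h, define γ(h) = ∫_{−π}^{π} (2|sin(λ/2)|)^{−2d} cos(hλ) dλ. Then h^{1−2d} γ(h) → 2 Γ(1 − 2d) sin(πd) as h → ∞. -/

import Mathlib

open Real Filter intervalIntegral

theorem intervalIntegrable_two_mul_sin_half_rpow {r : ℝ} (hr : -1 < r) (hr0 : r ≤ 0) :
    IntervalIntegrable (fun x : ℝ => (2 * Real.sin (x / 2)) ^ r) MeasureTheory.volume 0 π := by
  refine ((intervalIntegrable_rpow' (a := 0) (b := π) hr).const_mul ((2 / π) ^ r)).mono_fun' ?_ ?_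
  · exact (by fun_prop : Measurable fun x : ℝ => (2 * Real.sin (x / 2)) ^ r).aestronglyMeasurable
  · rw [Set.uIoc_of_le pi_pos.le]
    refine (MeasureTheory.ae_restrict_iff' measurableSet_Ioc).2 (.of_forall fun x hx => ?_)
    have hsin := mul_le_sin (x := x / 2) (by linarith [hx.1]) (by linarith [hx.2])
    have hpos : 0 < 2 / π * x := mul_pos (by positivity) hx.1
    have hle : 2 / π * x ≤ 2 * Real.sin (x / 2) := by linarith
    simp only
    rw [Real.norm_of_nonneg (rpow_nonneg (hpos.le.trans hle) r),
      ← mul_rpow (by positivity) hx.1.le]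
    exact rpow_le_rpow_of_nonpos hpos hle hr0

theorem intervalIntegrable_two_mul_sin_half_rpow_mul_cos {r : ℝ} (hr : -1 < r) (hr0 : r ≤ 0)
    (a : ℝ) :
    IntervalIntegrable (fun x : ℝ => (2 * Real.sin (x / 2)) ^ r * Real.cos (a * x))
      MeasureTheory.volume 0 π :=
  (intervalIntegrable_two_mul_sin_half_rpow hr hr0).mul_continuousOn (by fun_prop)

theorem integral_two_mul_abs_sin_half_rpow_mul_cos {r : ℝ} (hr : -1 < r) (hr0 : r ≤ 0) (a : ℝ) :
    ∫ x in (-π)..π, (2 * |Real.sin (x / 2)|) ^ r * Real.cos (a * x) =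
      2 * ∫ x in (0 : ℝ)..π, (2 * Real.sin (x / 2)) ^ r * Real.cos (a * x) := by
  set f : ℝ → ℝ := fun x => (2 * |Real.sin (x / 2)|) ^ r * Real.cos (a * x) with hf
  have heven : ∀ x, f (-x) = f x := fun x => by simp [hf, neg_div]
  have heq : Set.EqOn (fun x => (2 * Real.sin (x / 2)) ^ r * Real.cos (a * x)) f
      (Set.uIcc 0 π) := fun x hx => by
    rw [Set.uIcc_of_le pi_pos.le] at hx
    simp only [hf]
    rw [abs_of_nonneg
      (sin_nonneg_of_nonneg_of_le_pi (by linarith [hx.1]) (by linarith [hx.2, pi_pos]))]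
  have hright : IntervalIntegrable f MeasureTheory.volume 0 π :=
    (intervalIntegrable_two_mul_sin_half_rpow_mul_cos hr hr0 a).congr
      (heq.mono Set.uIoc_subset_uIcc)
  have hleft : IntervalIntegrable f MeasureTheory.volume (-π) 0 := by
    have := (hright.comp_sub_left 0).symm
    simpa [heven] using this
  have hrefl : ∫ x in (-π)..0, f x = ∫ x in (0 : ℝ)..π, f x := by
    have := integral_comp_neg (a := 0) (b := π) f
    simp only [heven, neg_zero] at this
    exact this.symm
  rw [← integral_add_adjacent_intervals hleft hright, hrefl, integral_congr heq]
  ring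

theorem hasDerivAt_two_mul_sin_half_rpow_mul_cos (d a x : ℝ) (hx : 0 < Real.sin (x / 2)) :
    HasDerivAt (fun x : ℝ => (2 * Real.sin (x / 2)) ^ (1 - 2 * d) * Real.cos ((a + 1 / 2) * x))
      ((a + 1 - d) * ((2 * Real.sin (x / 2)) ^ (-(2 * d)) * Real.cos ((a + 1) * x)) -
        (a + d) * ((2 * Real.sin (x / 2)) ^ (-(2 * d)) * Real.cos (a * x))) x := by
  have h1 : HasDerivAt (fun x : ℝ => 2 * Real.sin (x / 2)) (Real.cos (x / 2)) x :=
    ((((hasDerivAt_id' x).div_const 2).sin).const_mul 2).congr_deriv (by ring)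
  have h2 := h1.rpow_const (p := 1 - 2 * d) (Or.inl (by positivity))
  have h3 : HasDerivAt (fun x : ℝ => Real.cos ((a + 1 / 2) * x))
      (-Real.sin ((a + 1 / 2) * x) * (a + 1 / 2)) x := by
    simpa using ((hasDerivAt_id x).const_mul (a + 1 / 2)).cos
  refine (h2.mul h3).congr_deriv ?_
  have e1 : (1 - 2 * d - 1) = -(2 * d) := by ring
  have e2 : (2 * Real.sin (x / 2)) ^ (1 - 2 * d) =
      (2 * Real.sin (x / 2)) ^ (-(2 * d)) * (2 * Real.sin (x / 2)) := by
    rw [← rpow_add_one (by positivity)]; congr 1; ring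
  rw [e1, e2, show (a + 1) * x = (a + 1 / 2) * x + x / 2 by ring,
    show a * x = (a + 1 / 2) * x - x / 2 by ring, Real.cos_add, Real.cos_sub]
  ring

theorem integral_two_mul_sin_half_rpow_mul_cos_recurrence {d : ℝ} (hd0 : 0 ≤ d) (hd : d < 1 / 2)
    (n : ℕ) :
    (n + 1 - d) * ∫ x in (0 : ℝ)..π,
        (2 * Real.sin (x / 2)) ^ (-(2 * d)) * Real.cos ((n + 1 : ℝ) * x) =
      (n + d) * ∫ x in (0 : ℝ)..π,
        (2 * Real.sin (x / 2)) ^ (-(2 * d)) * Real.cos (n * x) := by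
  have hint := fun a => intervalIntegrable_two_mul_sin_half_rpow_mul_cos
    (r := -(2 * d)) (by linarith) (by linarith) a
  have hcont : ContinuousOn (fun x : ℝ =>
      (2 * Real.sin (x / 2)) ^ (1 - 2 * d) * Real.cos (((n : ℝ) + 1 / 2) * x)) (Set.Icc 0 π) := by
    refine ContinuousOn.mul (ContinuousOn.rpow_const (by fun_prop) fun x _ => ?_) (by fun_prop)
    exact Or.inr (by linarith)
  have key := integral_eq_sub_of_hasDerivAt_of_le pi_pos.le hcont
    (fun x hx => hasDerivAt_two_mul_sin_half_rpow_mul_cos d n x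
      (sin_pos_of_pos_of_lt_pi (by linarith [hx.1]) (by linarith [hx.2, pi_pos])))
    (((hint _).const_mul _).sub ((hint _).const_mul _))
  have hcos : Real.cos (((n : ℝ) + 1 / 2) * π) = 0 :=
    Real.cos_eq_zero_iff.2 ⟨n, by push_cast; ring⟩
  rw [integral_sub ((hint _).const_mul _) ((hint _).const_mul _), integral_const_mul,
    integral_const_mul, hcos, zero_div, Real.sin_zero, mul_zero (2 : ℝ),
    zero_rpow (by linarith : 1 - 2 * d ≠ 0)] at key
  linarith

theorem image_sin_half_sq_Ioo :
    (fun x : ℝ => Real.sin (x / 2) ^ 2) '' Set.Ioo 0 π = Set.Ioo 0 1 := by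
  ext t
  constructor
  · rintro ⟨x, hx, rfl⟩
    have hs : 0 < Real.sin (x / 2) :=
      sin_pos_of_pos_of_lt_pi (by linarith [hx.1]) (by linarith [hx.2, pi_pos])
    have hc : 0 < Real.cos (x / 2) :=
      cos_pos_of_mem_Ioo ⟨by linarith [hx.1, pi_pos], by linarith [hx.2]⟩
    exact ⟨by positivity, by nlinarith [Real.sin_sq_add_cos_sq (x / 2)]⟩
  · rintro ⟨h0, h1⟩
    refine ⟨2 * Real.arcsin √t, ⟨?_, ?_⟩, ?_⟩
    · have := Real.arcsin_pos.2 (Real.sqrt_pos.2 h0)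
      linarith
    · have := Real.arcsin_lt_pi_div_two.2 ((Real.sqrt_lt' one_pos).2 (by simpa using h1))
      linarith
    · simp only [mul_div_cancel_left₀ _ (two_ne_zero' ℝ)]
      rw [Real.sin_arcsin (by linarith [Real.sqrt_nonneg t]) (Real.sqrt_le_one.2 h1.le),
        Real.sq_sqrt h0.le]

theorem injOn_sin_half_sq : Set.InjOn (fun x : ℝ => Real.sin (x / 2) ^ 2) (Set.Ioo 0 π) := by
  intro x hx y hy hxy
  have hs : ∀ z ∈ Set.Ioo 0 π, 0 ≤ Real.sin (z / 2) := fun z hz =>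
    sin_nonneg_of_nonneg_of_le_pi (by linarith [hz.1]) (by linarith [hz.2, pi_pos])
  have h := (sq_eq_sq₀ (hs x hx) (hs y hy)).1 hxy
  have := Real.injOn_sin (x₁ := x / 2) (x₂ := y / 2)
    ⟨by linarith [hx.1, pi_pos], by linarith [hx.2]⟩
    ⟨by linarith [hy.1, pi_pos], by linarith [hy.2]⟩ h
  linarith

theorem integral_Ioo_rpow_mul_one_sub_rpow {u v : ℝ} (hu : 0 < u) (hv : 0 < v) :
    ∫ t in Set.Ioo (0 : ℝ) 1, t ^ (u - 1) * (1 - t) ^ (v - 1) =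
      Real.Gamma u * Real.Gamma v / Real.Gamma (u + v) := by
  have h := Complex.betaIntegral_eq_Gamma_mul_div u v (by simpa) (by simpa)
  rw [Complex.betaIntegral, integral_of_le zero_le_one, MeasureTheory.integral_Ioc_eq_integral_Ioo,
    MeasureTheory.setIntegral_congr_fun measurableSet_Ioo
      (g := fun t : ℝ => ((t ^ (u - 1) * (1 - t) ^ (v - 1) : ℝ) : ℂ)), integral_complex_ofReal,
    ← Complex.ofReal_add, Complex.Gamma_ofReal, Complex.Gamma_ofReal, Complex.Gamma_ofReal] at h
  · exact_mod_cast h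
  · intro t ht
    simp only
    rw [Complex.ofReal_mul, Complex.ofReal_cpow ht.1.le, Complex.ofReal_cpow (by linarith [ht.2])]
    push_cast
    rfl

theorem integral_sin_half_rpow {r : ℝ} (hr : -1 < r) :
    ∫ x in (0 : ℝ)..π, Real.sin (x / 2) ^ r =
      Real.Gamma ((r + 1) / 2) * √π / Real.Gamma (r / 2 + 1) := by
  have h := MeasureTheory.integral_image_eq_integral_abs_deriv_smul
    (f := fun x : ℝ => Real.sin (x / 2) ^ 2)
    (f' := fun x => Real.sin (x / 2) * Real.cos (x / 2)) (s := Set.Ioo 0 π) measurableSet_Ioo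
    (fun x _ => by
      refine HasDerivAt.hasDerivWithinAt
        (((((hasDerivAt_id' x).div_const 2).sin).pow 2).congr_deriv ?_)
      push_cast
      ring) injOn_sin_half_sq
    (fun t => t ^ ((r + 1) / 2 - 1) * (1 - t) ^ ((1 / 2 : ℝ) - 1))
  rw [image_sin_half_sq_Ioo, integral_Ioo_rpow_mul_one_sub_rpow (by linarith) (by norm_num),
    Real.Gamma_one_half_eq, show (r + 1) / 2 + 1 / 2 = r / 2 + 1 by ring] at h
  rw [h, integral_of_le pi_pos.le, MeasureTheory.integral_Ioc_eq_integral_Ioo]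
  refine MeasureTheory.setIntegral_congr_fun measurableSet_Ioo fun x hx => ?_
  have hs : 0 < Real.sin (x / 2) :=
    sin_pos_of_pos_of_lt_pi (by linarith [hx.1]) (by linarith [hx.2, pi_pos])
  have hc : 0 < Real.cos (x / 2) :=
    cos_pos_of_mem_Ioo ⟨by linarith [hx.1, pi_pos], by linarith [hx.2]⟩
  simp only [smul_eq_mul]
  rw [abs_of_pos (mul_pos hs hc), ← Real.cos_sq', ← rpow_natCast, ← rpow_natCast,
    ← rpow_mul hs.le, ← rpow_mul hc.le]
  have e1 : ((2 : ℕ) : ℝ) * ((r + 1) / 2 - 1) = r - 1 := by push_cast; ring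
  have e2 : ((2 : ℕ) : ℝ) * (1 / 2 - 1) = -1 := by norm_num
  rw [e1, e2, rpow_neg_one, rpow_sub_one hs.ne']
  field_simp

theorem integral_two_mul_sin_half_rpow {d : ℝ} (hd : d < 1 / 2) :
    ∫ x in (0 : ℝ)..π, (2 * Real.sin (x / 2)) ^ (-(2 * d)) =
      π * Real.Gamma (1 - 2 * d) / Real.Gamma (1 - d) ^ 2 := by
  have hcongr : ∫ x in (0 : ℝ)..π, (2 * Real.sin (x / 2)) ^ (-(2 * d)) =
      ∫ x in (0 : ℝ)..π, (2 : ℝ) ^ (-(2 * d)) * Real.sin (x / 2) ^ (-(2 * d)) := by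
    refine integral_congr fun x hx => ?_
    rw [Set.uIcc_of_le pi_pos.le] at hx
    exact mul_rpow zero_le_two
      (sin_nonneg_of_nonneg_of_le_pi (by linarith [hx.1]) (by linarith [hx.2, pi_pos]))
  have hdup := Real.Gamma_mul_Gamma_add_half (1 / 2 - d)
  rw [show 1 / 2 - d + 1 / 2 = 1 - d by ring, show 2 * (1 / 2 - d) = 1 - 2 * d by ring,
    show 1 - (1 - 2 * d) = 2 * d by ring] at hdup
  have hG : 0 < Real.Gamma (1 - d) := Real.Gamma_pos_of_pos (by linarith)
  rw [hcongr, integral_const_mul, integral_sin_half_rpow (by linarith),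
    show (-(2 * d) + 1) / 2 = 1 / 2 - d by ring, show -(2 * d) / 2 + 1 = 1 - d by ring,
    rpow_neg zero_le_two, eq_div_iff (by positivity)]
  have h2 : (0 : ℝ) < 2 ^ (2 * d) := by positivity
  have hpi := Real.mul_self_sqrt pi_pos.le
  generalize Real.Gamma (1 / 2 - d) = G at hdup ⊢
  field_simp
  linear_combination √π * hdup + Real.Gamma (1 - 2 * d) * 2 ^ (2 * d) * hpi

theorem integral_two_mul_sin_half_rpow_mul_cos_eq_prod {d : ℝ} (hd0 : 0 ≤ d) (hd : d < 1 / 2)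
    (n : ℕ) :
    ∫ x in (0 : ℝ)..π, (2 * Real.sin (x / 2)) ^ (-(2 * d)) * Real.cos (n * x) =
      π * Real.Gamma (1 - 2 * d) / Real.Gamma (1 - d) ^ 2 *
        ((∏ j ∈ Finset.range n, (d + j)) / ∏ j ∈ Finset.range n, (1 - d + j)) := by
  induction n with
  | zero => simp [← integral_two_mul_sin_half_rpow hd]
  | succ n ih =>
    have hrec := integral_two_mul_sin_half_rpow_mul_cos_recurrence hd0 hd n
    have hne : (n : ℝ) + 1 - d ≠ 0 := by
      have := n.cast_nonneg (α := ℝ)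
      linarith
    rw [ih] at hrec
    rw [Nat.cast_succ, ← mul_right_inj' hne, hrec, Finset.prod_range_succ, Finset.prod_range_succ,
      mul_div_mul_comm, show 1 - d + (n : ℝ) = n + 1 - d by ring]
    field_simp
    ring

/-- Power-law decay of the autocovariances of a fractionally differenced process
(Proposition 1(c) of the paper, non-seasonal case): for `0 < d < 1/2` and
`γ(h) = ∫_{-π}^{π} (2|sin(λ/2)|)^{-2d} cos(hλ) dλ`, one has
`h^{1-2d} γ(h) → 2 Γ(1-2d) sin(πd)` as `h → ∞`. -/
theorem fractional_autocovariance_decay (d : ℝ) (hd0 : 0 < d) (hd : d < 1 / 2) :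
    Tendsto
      (fun h : ℕ =>
        (h : ℝ) ^ (1 - 2 * d) *
          ∫ lam in (-Real.pi)..Real.pi,
            (2 * |Real.sin (lam / 2)|) ^ (-(2 * d)) * Real.cos (h * lam))
      atTop (nhds (2 * Real.Gamma (1 - 2 * d) * Real.sin (Real.pi * d))) := by
  have hG : 0 < Real.Gamma d := Real.Gamma_pos_of_pos hd0
  have hG' : 0 < Real.Gamma (1 - d) := Real.Gamma_pos_of_pos (by linarith)
  have hseq := (Real.GammaSeq_tendsto_Gamma (1 - d)).div (Real.GammaSeq_tendsto_Gamma d) hG.ne'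
  have hfrac : Tendsto (fun n : ℕ => 1 + (1 - 2 * d) / ((n : ℝ) + d)) atTop (nhds (1 + 0)) :=
    tendsto_const_nhds.add (tendsto_const_nhds.div_atTop
      (tendsto_atTop_add_const_right _ _ tendsto_natCast_atTop_atTop))
  have hlim := (hseq.mul hfrac).const_mul
    (2 * (π * Real.Gamma (1 - 2 * d) / Real.Gamma (1 - d) ^ 2))
  have hrefl := Real.Gamma_mul_Gamma_one_sub d
  have hsin : 0 < Real.sin (π * d) :=
    sin_pos_of_pos_of_lt_pi (by positivity) (by nlinarith [pi_pos])
  have hval : 2 * (π * Real.Gamma (1 - 2 * d) / Real.Gamma (1 - d) ^ 2) *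
      (Real.Gamma (1 - d) / Real.Gamma d * (1 + 0)) =
      2 * Real.Gamma (1 - 2 * d) * Real.sin (π * d) := by
    rw [eq_div_iff hsin.ne'] at hrefl
    field_simp
    linear_combination -Real.Gamma (1 - 2 * d) * hrefl
  rw [hval] at hlim
  refine hlim.congr' ?_
  filter_upwards [eventually_gt_atTop 0] with n hn
  have hn' : (0 : ℝ) < n := by exact_mod_cast hn
  rw [integral_two_mul_abs_sin_half_rpow_mul_cos (by linarith) (by linarith),
    integral_two_mul_sin_half_rpow_mul_cos_eq_prod hd0.le hd]
  have hP : 0 < ∏ j ∈ Finset.range n, (d + (j : ℝ)) :=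
    Finset.prod_pos fun j _ => by positivity
  have hQ : 0 < ∏ j ∈ Finset.range n, (1 - d + (j : ℝ)) :=
    Finset.prod_pos fun j _ => by linarith [j.cast_nonneg (α := ℝ)]
  have hpow : (n : ℝ) ^ (1 - d) = (n : ℝ) ^ (1 - 2 * d) * (n : ℝ) ^ d := by
    rw [← rpow_add hn']; congr 1; ring
  have hnd : (0 : ℝ) < n ^ d := by positivity
  have hfact : (0 : ℝ) < n.factorial := by positivity
  have h1 : (0 : ℝ) < n + d := by positivity
  have h2 : (0 : ℝ) < 1 - d + n := by linarith
  simp only [Pi.div_apply, Real.GammaSeq, Finset.prod_range_succ, hpow]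
  rw [show d + (n : ℝ) = n + d by ring]
  field_simp
  ring
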